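/- Let F = (V_0,…,V_{k−1}) be an isotropic partial flag of type d in V with completion (V̄_0,…,V̄_{2k−1}), and let c be an admissible self-dual sequence. Let x, y ∈ End(V) be ω-adjoint to one another, i.e. ω(x(v), w) = ω(v, y(w)) for all v, w ∈ V. If x(V̄_p) ⊆ V̄_{c_p} for all p = 0,…,2k−1, then also y(V̄_p) ⊆ V̄_{c_p} for all p = 0,…,2k−1. -/

import Mathlib

open Module Submodule

noncomputable section

/-- The orthogonal `W^⊥ = {v : ω(v,w) = 0 for all w ∈ W}` of a subspace with respect to a
bilinear form `ω`. -/
def ortho {V : Type*} [AddCommGroup V] [Module ℂ V]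
    (ω : V →ₗ[ℂ] V →ₗ[ℂ] ℂ) (W : Submodule ℂ V) : Submodule ℂ V where
  carrier := {v | ∀ w ∈ W, ω v w = 0}
  zero_mem' := by intro w _; simp
  add_mem' := by
    intro a b ha hb w hw
    rw [map_add, LinearMap.add_apply, ha w hw, hb w hw, add_zero]
  smul_mem' := by
    intro t a ha w hw
    rw [map_smul, LinearMap.smul_apply, ha w hw, smul_zero]

/-- The completion `(V̄_0, …, V̄_{2k−1})` of an isotropic partial flag `(V_0, …, V_{k−1})`:
`V̄_p = V_p` for `p ≤ k−1` and `V̄_p = (V_{2k−1−p})^⊥` for `k ≤ p ≤ 2k−1`. -/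
def completion {V : Type*} [AddCommGroup V] [Module ℂ V]
    (ω : V →ₗ[ℂ] V →ₗ[ℂ] ℂ) {k : ℕ} (W : Fin k → Submodule ℂ V) :
    ℕ → Submodule ℂ V := fun p =>
  if h : p < k then W ⟨p, h⟩
  else if h2 : 2 * k - 1 - p < k then ortho ω (W ⟨2 * k - 1 - p, h2⟩) else ⊥

theorem aux_pair {V : Type*} [AddCommGroup V] [Module ℂ V]
    (ω : V →ₗ[ℂ] V →ₗ[ℂ] ℂ) (hr : ∀ v w, ω v w = 0 → ω w v = 0)
    {k : ℕ} (F : Fin k → Submodule ℂ V) (hFmono : Monotone F)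
    (hFiso : ∀ p, ∀ v ∈ F p, ∀ w ∈ F p, ω v w = 0)
    (p q : ℕ) (hpq : p + q < 2 * k) (hpq' : p ≤ q) (u v : V) (hu : u ∈ completion ω F p)
    (hv : v ∈ completion ω F q) : ω v u = 0 := by
  have hp : p < k := by omega
  simp only [completion, dif_pos hp] at hu
  by_cases hq : q < k
  · simp only [completion, dif_pos hq] at hv
    exact hFiso _ v hv u (hFmono (by simpa using hpq') hu)
  · have h2 : 2 * k - 1 - q < k := by omega
    simp only [completion, dif_neg hq, dif_pos h2] at hv
    exact hv u (hFmono (by simp only [Fin.mk_le_mk]; omega) hu)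

theorem aux_mem {V : Type*} [AddCommGroup V] [Module ℂ V] [FiniteDimensional ℂ V]
    (ω : V →ₗ[ℂ] V →ₗ[ℂ] ℂ) (hnd : ∀ v, (∀ w, ω v w = 0) → v = 0)
    (hr : ∀ v w, ω v w = 0 → ω w v = 0)
    {k : ℕ} (F : Fin k → Submodule ℂ V)
    (p : ℕ) (hp : p < 2 * k) (v : V)
    (hv : ∀ u ∈ completion ω F (2 * k - 1 - p), ω v u = 0) : v ∈ completion ω F p := by
  by_cases hq : p < k
  · have h1 : ¬ (2 * k - 1 - p < k) := by omega
    have h2 : 2 * k - 1 - (2 * k - 1 - p) < k := by omega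
    have h3 : 2 * k - 1 - (2 * k - 1 - p) = p := by omega
    simp only [completion, dif_neg h1, dif_pos h2] at hv
    simp only [completion, dif_pos hq]
    have hN : LinearMap.BilinForm.Nondegenerate ω :=
      ⟨hnd, fun v h => hnd v fun w => hr _ _ (h w)⟩
    have hR : LinearMap.BilinForm.IsRefl ω := hr
    rw [← LinearMap.BilinForm.orthogonal_orthogonal hN hR (F ⟨p, hq⟩)]
    intro u hu
    refine hr _ _ (hv u ?_)
    intro w hw
    simp only [h3] at hw
    exact hr _ _ (hu w hw)
  · have h2 : 2 * k - 1 - p < k := by omega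
    simp only [completion, dif_neg hq, dif_pos h2] at hv ⊢
    exact hv

/-- If `x` and `y` are `ω`-adjoint to one another and `x` satisfies the
conditions `x(V̄_p) ⊆ V̄_{c_p}` defining `𝔦^F_c` (for an admissible self-dual sequence `c`),
then so does `y`. -/
theorem stmt_13 (V : Type*) [AddCommGroup V] [Module ℂ V] [FiniteDimensional ℂ V]
    (m : ℕ) (hdimV : finrank ℂ V = m)
    (ω : V →ₗ[ℂ] V →ₗ[ℂ] ℂ)
    (hnd : ∀ v, (∀ w, ω v w = 0) → v = 0)
    (hso : (∀ v w, ω v w = ω w v) ∨ (∀ v, ω v v = 0))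
    (k : ℕ) (hk : 2 ≤ k)
    (d : Fin k → ℕ) (hd0 : d ⟨0, by omega⟩ = 0) (hdsm : StrictMono d)
    (hdm : 2 * d ⟨k - 1, by omega⟩ ≤ m)
    (F : Fin k → Submodule ℂ V) (hFmono : Monotone F)
    (hFiso : ∀ p, ∀ v ∈ F p, ∀ w ∈ F p, ω v w = 0)
    (hFdim : ∀ p, finrank ℂ (F p) = d p)
    (c : ℕ → ℕ)
    (hcmono : ∀ p q, p ≤ q → q < 2 * k → c p ≤ c q)
    (hcle : ∀ p < 2 * k, c p ≤ p)
    (hcsd : ∀ p < 2 * k, c p = ((Finset.Ico 1 (2 * k)).filter fun q => 2 * k - p ≤ c q).card)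
    (x y : Module.End ℂ V)
    (hadj : ∀ v w, ω (x v) w = ω v (y w))
    (hx : ∀ p < 2 * k, (completion ω F p).map x ≤ completion ω F (c p)) :
    ∀ p < 2 * k, (completion ω F p).map y ≤ completion ω F (c p) := by
  have hr : ∀ v w, ω v w = 0 → ω w v = 0 := by
    intro v w h
    rcases hso with h1 | h1
    · rw [h1, h]
    · have := h1 (v + w)
      simp only [map_add, LinearMap.add_apply, h1, h] at this
      simpa using this
  rintro p hp _ ⟨v, hv, rfl⟩
  have hcp := hcle p hp
  refine aux_mem ω hnd hr F _ (by omega) _ ?_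
  intro u hu
  apply hr
  rw [← hadj]
  have hxu : x u ∈ completion ω F (c (2 * k - 1 - c p)) :=
    hx _ (by omega) ⟨u, hu, rfl⟩
  have key : c (2 * k - 1 - c p) + p < 2 * k := by
    by_contra hcon
    have h0 := hcle (2 * k - 1 - c p) (by omega)
    have hsub : Finset.Ico (2 * k - 1 - c p) (2 * k) ⊆
        (Finset.Ico 1 (2 * k)).filter fun q => 2 * k - p ≤ c q := by
      intro q hq
      rw [Finset.mem_Ico] at hq
      rw [Finset.mem_filter, Finset.mem_Ico]
      have := hcmono _ q hq.1 hq.2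
      omega
    have h1 := Finset.card_le_card hsub
    rw [← hcsd p hp, Nat.card_Ico] at h1
    omega
  rcases le_total p (c (2 * k - 1 - c p)) with h | h
  · exact aux_pair ω hr F hFmono hFiso _ _ (by omega) h _ _ hv hxu
  · exact hr _ _ (aux_pair ω hr F hFmono hFiso _ _ key h _ _ hxu hv)
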